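/- Fix an integer N ≥ 2 and let μ be a non-atomic Borel probability measure on [0,1]. If for some n ∈ ℕ the function F_{N,n} is differentiable on [0,1] with bounded derivative, then F_{N,n+1} is differentiable on [0,1] with bounded derivative, and for all x ∈ [0,1], F'_{N,n+1}(x) = Σ_{i≥N} (N/(x+i)²) · F'_{N,n}(1 − N/(x+i)). -/

import Mathlib

open MeasureTheory Set Filter

/-- The Rényi-type continued fraction transformation
`R_N(x) = N/(1-x) - ⌊N/(1-x)⌋` for `x ≠ 1`, and `R_N(1) = 0`. -/
noncomputable def renyiMap (N : ℕ) (x : ℝ) : ℝ :=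
  if x = 1 then 0 else Int.fract ((N : ℝ) / (1 - x))

/-- `F_{N,n}(x) = μ {y ∈ [0,1] : R_N^n(y) ≤ x}`. -/
noncomputable def Fdist (N : ℕ) (μ : Measure ℝ) (n : ℕ) (x : ℝ) : ℝ :=
  (μ {y ∈ Icc (0 : ℝ) 1 | (renyiMap N)^[n] y ≤ x}).toReal

open Topology

/-- Termwise differentiation of a series within a convex set. -/
theorem hasDerivWithinAt_tsum_of_convex {ι : Type*} {s : Set ℝ} (hs : Convex ℝ s)
    {g g' : ι → ℝ → ℝ} {u : ι → ℝ} (hu : Summable u)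
    (hg : ∀ i, ∀ y ∈ s, HasDerivWithinAt (g i) (g' i y) s y)
    (hb : ∀ i, ∀ y ∈ s, ‖g' i y‖ ≤ u i)
    (hsum : ∀ y ∈ s, Summable fun i => g i y) {x : ℝ} (hx : x ∈ s) :
    HasDerivWithinAt (fun y => ∑' i, g i y) (∑' i, g' i x) s x := by
  rw [hasDerivWithinAt_iff_tendsto_slope]
  have key : Tendsto (fun y => ∑' i, slope (g i) x y) (𝓝[s \ {x}] x) (𝓝 (∑' i, g' i x)) := by
    refine tendsto_tsum_of_dominated_convergence hu
      (fun i => hasDerivWithinAt_iff_tendsto_slope.1 (hg i x hx)) ?_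
    filter_upwards [self_mem_nhdsWithin] with y hy i
    have h := hs.norm_image_sub_le_of_norm_hasDerivWithin_le (hg i) (hb i) hx hy.1
    have hpos : 0 < ‖y - x‖ := norm_pos_iff.2 (sub_ne_zero.2 hy.2)
    rwa [slope_def_field, norm_div, div_le_iff₀ hpos]
  refine key.congr' ?_
  filter_upwards [self_mem_nhdsWithin] with y hy
  simp only [slope_def_field]
  rw [tsum_div_const, (hsum y hy.1).tsum_sub (hsum x hx)]

theorem measurable_renyiMap (N : ℕ) : Measurable (renyiMap N) := by
  refine Measurable.ite (measurableSet_singleton 1) measurable_const ?_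
  exact measurable_fract.comp (measurable_const.div (measurable_const.sub measurable_id))

theorem renyiMap_mem_Icc (N : ℕ) (x : ℝ) : renyiMap N x ∈ Icc (0 : ℝ) 1 := by
  unfold renyiMap
  split_ifs
  · simp
  · exact ⟨Int.fract_nonneg _, (Int.fract_lt_one _).le⟩

theorem countable_renyiMap_preimage_singleton {N : ℕ} (hN : N ≠ 0) (t : ℝ) :
    (renyiMap N ⁻¹' {t}).Countable := by
  refine ((countable_range fun k : ℤ => 1 - (N : ℝ) / (t + k)).insert 1).mono ?_
  intro z hz
  by_cases h1 : z = 1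
  · exact Or.inl h1
  · right
    have h0 : (1 : ℝ) - z ≠ 0 := sub_ne_zero.2 (Ne.symm h1)
    have hN' : (N : ℝ) ≠ 0 := Nat.cast_ne_zero.2 hN
    refine ⟨⌊(N : ℝ) / (1 - z)⌋, ?_⟩
    have ht : Int.fract ((N : ℝ) / (1 - z)) = t := by simpa [renyiMap, h1] using hz
    have hw : t + ⌊(N : ℝ) / (1 - z)⌋ = (N : ℝ) / (1 - z) := by
      rw [← ht, Int.fract_add_floor]
    simp only [hw]
    field_simp
    ring

/-- The law of the `n`-th iterate of `renyiMap N` under `μ` restricted to `[0, 1]`. -/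
noncomputable def renyiLaw (N : ℕ) (μ : Measure ℝ) (n : ℕ) : Measure ℝ :=
  (μ.restrict (Icc 0 1)).map (renyiMap N)^[n]

theorem renyiLaw_succ (N : ℕ) (μ : Measure ℝ) (n : ℕ) :
    renyiLaw N μ (n + 1) = (renyiLaw N μ n).map (renyiMap N) := by
  rw [renyiLaw, renyiLaw, Measure.map_map (measurable_renyiMap N)
    ((measurable_renyiMap N).iterate n), Function.iterate_succ']

theorem Fdist_eq_renyiLaw (N : ℕ) (μ : Measure ℝ) (n : ℕ) (x : ℝ) :
    Fdist N μ n x = (renyiLaw N μ n).real (Iic x) := by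
  have hm := (measurable_renyiMap N).iterate n
  rw [Fdist, renyiLaw, Measure.real, Measure.map_apply hm measurableSet_Iic,
    Measure.restrict_apply (hm measurableSet_Iic), inter_comm]
  rfl

instance (N : ℕ) (μ : Measure ℝ) [IsFiniteMeasure μ] (n : ℕ) :
    IsFiniteMeasure (renyiLaw N μ n) := by
  unfold renyiLaw; infer_instance

theorem ae_renyiLaw_mem_Icc (N : ℕ) (μ : Measure ℝ) (n : ℕ) :
    ∀ᵐ z ∂renyiLaw N μ n, z ∈ Icc (0 : ℝ) 1 := by
  cases n with
  | zero =>
    simpa [renyiLaw] using ae_restrict_mem (μ := μ) (measurableSet_Icc (a := (0 : ℝ)) (b := 1))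
  | succ n =>
    rw [renyiLaw_succ]
    exact (ae_map_iff (measurable_renyiMap N).aemeasurable measurableSet_Icc).2
      (ae_of_all _ (renyiMap_mem_Icc N))

theorem renyiLaw_nullSingletonClass {N : ℕ} (hN : N ≠ 0) (μ : Measure ℝ)
    [NullSingletonClass μ] (n : ℕ) : NullSingletonClass (renyiLaw N μ n) := by
  induction n with
  | zero => simpa [renyiLaw] using (inferInstance : NullSingletonClass (μ.restrict (Icc 0 1)))
  | succ n ih =>
    refine ⟨fun t => ?_⟩
    rw [renyiLaw_succ, Measure.map_apply (measurable_renyiMap N) (measurableSet_singleton t)]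
    exact (countable_renyiMap_preimage_singleton hN t).measure_zero _

theorem measureReal_Ioc_eq_sub (ν : Measure ℝ) [IsFiniteMeasure ν] {a b : ℝ} (hab : a ≤ b) :
    ν.real (Ioc a b) = ν.real (Iic b) - ν.real (Iic a) := by
  rw [← Iic_sdiff_Iic, measureReal_sdiff (Iic_subset_Iic.2 hab) measurableSet_Iic]

theorem renyiMap_le_iff {N : ℕ} (hN : 0 < N) {x z : ℝ} (hx : x ∈ Icc (0 : ℝ) 1)
    (hz0 : 0 ≤ z) (hz1 : z < 1) (hz : ∀ j : ℕ, z ≠ 1 - (N : ℝ) / ((j + N : ℕ) : ℝ)) :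
    renyiMap N z ≤ x ↔ z ∈ ⋃ j : ℕ, Ioc (1 - (N : ℝ) / ((j + N : ℕ) : ℝ))
      (1 - (N : ℝ) / (x + ((j + N : ℕ) : ℝ))) := by
  have hN' : (0 : ℝ) < N := Nat.cast_pos.2 hN
  have hp : 0 < 1 - z := sub_pos.2 hz1
  have hpos : ∀ j : ℕ, (0 : ℝ) < ((j + N : ℕ) : ℝ) := fun j => Nat.cast_pos.2 (by omega)
  have hlt : ∀ j : ℕ, 1 - (N : ℝ) / ((j + N : ℕ) : ℝ) < z ↔
      ((j + N : ℕ) : ℝ) < N / (1 - z) := fun j => by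
    rw [sub_lt_comm, lt_div_iff₀ (hpos j), lt_div_iff₀ hp, mul_comm]
  have hle : ∀ j : ℕ, z ≤ 1 - (N : ℝ) / (x + ((j + N : ℕ) : ℝ)) ↔
      (N : ℝ) / (1 - z) ≤ x + ((j + N : ℕ) : ℝ) := fun j => by
    rw [le_sub_comm, div_le_iff₀ (add_pos_of_nonneg_of_pos hx.1 (hpos j)), div_le_iff₀ hp,
      mul_comm]
  have hne : ∀ j : ℕ, (N : ℝ) / (1 - z) ≠ ((j + N : ℕ) : ℝ) := fun j h => hz j (by
    rw [← h, div_div_cancel₀ hN'.ne']; ring)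
  simp only [mem_iUnion, mem_Ioc, hlt, hle, renyiMap, hz1.ne, if_false]
  have hNw : (N : ℝ) ≤ N / (1 - z) := le_div_self hN'.le hp (sub_le_self 1 hz0)
  generalize (N : ℝ) / (1 - z) = w at hNw hne ⊢
  constructor
  · intro hfr
    have hfloor : N ≤ ⌊w⌋₊ := Nat.le_floor hNw
    have hcast : ((⌊w⌋₊ - N + N : ℕ) : ℝ) = ⌊w⌋ := by
      rw [Nat.sub_add_cancel hfloor, natCast_floor_eq_intCast_floor (hN'.le.trans hNw)]
    refine ⟨⌊w⌋₊ - N, lt_of_le_of_ne ?_ (hne _).symm, ?_⟩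
    · rw [hcast]
      exact Int.floor_le w
    · rw [hcast]
      linarith [Int.fract_add_floor w]
  · rintro ⟨j, hlo, hhi⟩
    have hfloor : ⌊w⌋ = ((j + N : ℕ) : ℤ) := by
      refine Int.floor_eq_iff.2 ⟨by exact_mod_cast hlo.le, lt_of_le_of_ne ?_ ?_⟩
      · push_cast at hhi ⊢
        linarith [hx.2]
      · have h := hne (j + 1)
        rw [add_right_comm] at h
        exact_mod_cast h
    rw [Int.fract, hfloor, Int.cast_natCast]
    linarith

theorem hasSum_renyiMap_Iic {N : ℕ} (hN : 0 < N) (ν : Measure ℝ) [IsFiniteMeasure ν]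
    [NullSingletonClass ν] (hν : ∀ᵐ z ∂ν, z ∈ Icc (0 : ℝ) 1) {x : ℝ} (hx : x ∈ Icc (0 : ℝ) 1) :
    HasSum (fun j : ℕ => ν.real (Iic (1 - (N : ℝ) / (x + ((j + N : ℕ) : ℝ)))) -
      ν.real (Iic (1 - (N : ℝ) / ((j + N : ℕ) : ℝ)))) ((ν.map (renyiMap N)).real (Iic x)) := by
  have hpos : ∀ j : ℕ, (0 : ℝ) < ((j + N : ℕ) : ℝ) := fun j => Nat.cast_pos.2 (by omega)
  have hae : renyiMap N ⁻¹' Iic x =ᵐ[ν] ⋃ j : ℕ, Ioc (1 - (N : ℝ) / ((j + N : ℕ) : ℝ))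
      (1 - (N : ℝ) / (x + ((j + N : ℕ) : ℝ))) := by
    have hc : ∀ᵐ z ∂ν, z ∉ insert 1 (range fun j : ℕ => 1 - (N : ℝ) / ((j + N : ℕ) : ℝ)) :=
      measure_eq_zero_iff_ae_notMem.1 (((countable_range _).insert 1).measure_zero ν)
    filter_upwards [hν, hc] with z hz hz'
    simp only [mem_insert_iff, mem_range, not_or, not_exists] at hz'
    exact propext (renyiMap_le_iff hN hx hz.1 (lt_of_le_of_ne hz.2 hz'.1)
      fun j h => hz'.2 j h.symm)
  have hmono : Monotone fun j : ℕ => 1 - (N : ℝ) / ((j + N : ℕ) : ℝ) := fun i j hij => by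
    have := hpos i
    dsimp only
    gcongr
  have hdisj : Pairwise (Function.onFun Disjoint fun j : ℕ =>
      Ioc (1 - (N : ℝ) / ((j + N : ℕ) : ℝ)) (1 - (N : ℝ) / (x + ((j + N : ℕ) : ℝ)))) := by
    intro i j hij
    refine (hmono.pairwise_disjoint_on_Ioc_succ hij).mono ?_ ?_
    all_goals
      refine Ioc_subset_Ioc_right (sub_le_sub_left (div_le_div_of_nonneg_left (by positivity)
        (add_pos_of_nonneg_of_pos hx.1 (hpos _)) ?_) 1)
      have := hx.2
      simp only [Order.succ_eq_add_one]
      push_cast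
      linarith
  have hterm : ∀ j : ℕ, ν.real (Iic (1 - (N : ℝ) / (x + ((j + N : ℕ) : ℝ)))) -
      ν.real (Iic (1 - (N : ℝ) / ((j + N : ℕ) : ℝ))) =
      ν.real (Ioc (1 - (N : ℝ) / ((j + N : ℕ) : ℝ)) (1 - (N : ℝ) / (x + ((j + N : ℕ) : ℝ)))) :=
    fun j => (measureReal_Ioc_eq_sub ν (sub_le_sub_left (div_le_div_of_nonneg_left
      (by positivity) (hpos j) (le_add_of_nonneg_left hx.1)) 1)).symm
  simp only [hterm]
  rw [map_measureReal_apply (measurable_renyiMap N) measurableSet_Iic, measureReal_congr hae,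
    measureReal_def, measure_iUnion hdisj fun _ => measurableSet_Ioc,
    ENNReal.tsum_toReal_eq fun _ => measure_ne_top ν _]
  refine ENNReal.hasSum_toReal ?_
  rw [← measure_iUnion hdisj fun _ => measurableSet_Ioc]
  exact measure_ne_top ν _

/-- Differentiating the Gauss-Kuzmin equation term by term: if `F_{N,n}` is
differentiable with bounded derivative, so is `F_{N,n+1}`, and
`F'_{N,n+1}(x) = ∑_{i ≥ N} (N/(x+i)²) F'_{N,n}(1 - N/(x+i))` (sum via `i = j + N`). -/
theorem deriv_gauss_kuzmin (N : ℕ) (hN : 2 ≤ N) (μ : Measure ℝ)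
    [IsProbabilityMeasure μ] [NullSingletonClass μ] (hsupp : μ (Icc (0 : ℝ) 1)ᶜ = 0)
    (n : ℕ) (hdiff : DifferentiableOn ℝ (Fdist N μ n) (Icc 0 1))
    (hbdd : ∃ M : ℝ, ∀ x ∈ Icc (0 : ℝ) 1,
      |derivWithin (Fdist N μ n) (Icc 0 1) x| ≤ M) :
    DifferentiableOn ℝ (Fdist N μ (n + 1)) (Icc 0 1) ∧
      (∃ M : ℝ, ∀ x ∈ Icc (0 : ℝ) 1,
        |derivWithin (Fdist N μ (n + 1)) (Icc 0 1) x| ≤ M) ∧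
      ∀ x ∈ Icc (0 : ℝ) 1,
        derivWithin (Fdist N μ (n + 1)) (Icc 0 1) x =
          ∑' j : ℕ,
            (N : ℝ) / (x + ((j + N : ℕ) : ℝ)) ^ 2 *
              derivWithin (Fdist N μ n) (Icc 0 1)
                (1 - (N : ℝ) / (x + ((j + N : ℕ) : ℝ))) := by
  obtain ⟨M, hM⟩ := hbdd
  have hN0 : 0 < N := by omega
  have hpos : ∀ j : ℕ, (0 : ℝ) < ((j + N : ℕ) : ℝ) := fun j => Nat.cast_pos.2 (by omega)
  have := renyiLaw_nullSingletonClass hN0.ne' μ n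
  have hsum : ∀ x ∈ Icc (0 : ℝ) 1, HasSum (fun j : ℕ =>
      Fdist N μ n (1 - (N : ℝ) / (x + ((j + N : ℕ) : ℝ))) -
        Fdist N μ n (1 - (N : ℝ) / ((j + N : ℕ) : ℝ))) (Fdist N μ (n + 1) x) := fun x hx => by
    simp only [Fdist_eq_renyiLaw, renyiLaw_succ]
    exact hasSum_renyiMap_Iic hN0 _ (ae_renyiLaw_mem_Icc N μ n) hx
  have hmaps : ∀ j : ℕ, MapsTo (fun x : ℝ => 1 - (N : ℝ) / (x + ((j + N : ℕ) : ℝ)))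
      (Icc 0 1) (Icc 0 1) := fun j x hx => by
    have hxp := add_pos_of_nonneg_of_pos hx.1 (hpos j)
    refine ⟨sub_nonneg.2 ((div_le_one hxp).2 ?_), sub_le_self _ (by positivity)⟩
    have := hx.1
    push_cast
    linarith [(Nat.cast_nonneg j : (0 : ℝ) ≤ j)]
  have hM0 : 0 ≤ M := (abs_nonneg _).trans (hM 0 (by simp))
  have hu : Summable fun j : ℕ => (N : ℝ) / ((j + N : ℕ) : ℝ) ^ 2 * M := by
    have h := (summable_nat_add_iff N).2 (Real.summable_nat_pow_inv.2 one_lt_two)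
    simpa only [div_eq_mul_inv] using (h.mul_left (N : ℝ)).mul_right M
  have hb : ∀ j : ℕ, ∀ x ∈ Icc (0 : ℝ) 1, ‖(N : ℝ) / (x + ((j + N : ℕ) : ℝ)) ^ 2 *
      derivWithin (Fdist N μ n) (Icc 0 1) (1 - (N : ℝ) / (x + ((j + N : ℕ) : ℝ)))‖ ≤
      (N : ℝ) / ((j + N : ℕ) : ℝ) ^ 2 * M := fun j x hx => by
    have hj := hpos j
    rw [norm_mul, Real.norm_of_nonneg (by positivity)]
    refine mul_le_mul ?_ (hM _ (hmaps j hx)) (norm_nonneg _) (by positivity)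
    gcongr
    exact le_add_of_nonneg_left hx.1
  have hderiv : ∀ x ∈ Icc (0 : ℝ) 1, HasDerivWithinAt (Fdist N μ (n + 1))
      (∑' j : ℕ, (N : ℝ) / (x + ((j + N : ℕ) : ℝ)) ^ 2 *
        derivWithin (Fdist N μ n) (Icc 0 1) (1 - (N : ℝ) / (x + ((j + N : ℕ) : ℝ))))
      (Icc 0 1) x := fun x hx => by
    refine (hasDerivWithinAt_tsum_of_convex (convex_Icc 0 1) hu (fun j y hy => ?_) hb
      (fun y hy => (hsum y hy).summable) hx).congr (fun y hy => (hsum y hy).tsum_eq.symm)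
      (hsum x hx).tsum_eq.symm
    have hyp := add_pos_of_nonneg_of_pos hy.1 (hpos j)
    have hbranch : HasDerivWithinAt (fun x : ℝ => 1 - (N : ℝ) / (x + ((j + N : ℕ) : ℝ)))
        ((N : ℝ) / (y + ((j + N : ℕ) : ℝ)) ^ 2) (Icc 0 1) y := by
      have h := (((hasDerivAt_const y (N : ℝ)).div
        ((hasDerivAt_id y).add_const ((j + N : ℕ) : ℝ)) hyp.ne').const_sub 1).hasDerivWithinAt
        (s := Icc (0 : ℝ) 1)
      refine h.congr_deriv ?_
      simp [neg_div]
    have h := ((hdiff _ (hmaps j hy)).hasDerivWithinAt.comp y hbranch (hmaps j)).sub_const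
      (Fdist N μ n (1 - (N : ℝ) / ((j + N : ℕ) : ℝ)))
    exact h.congr_deriv (mul_comm _ _)
  have heq := fun x hx => (hderiv x hx).derivWithin (uniqueDiffOn_Icc_zero_one x hx)
  refine ⟨fun x hx => (hderiv x hx).differentiableWithinAt,
    ⟨∑' j : ℕ, (N : ℝ) / ((j + N : ℕ) : ℝ) ^ 2 * M, fun x hx => ?_⟩, heq⟩
  rw [heq x hx, ← Real.norm_eq_abs]
  exact tsum_of_norm_bounded hu.hasSum fun j => hb j x hx
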